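/- Brooks' theorem for signed graphs: let (G,σ) be a simple connected signed graph. If (G,σ) is not a balanced complete graph, not a balanced odd circuit, and not an unbalanced even circuit, then χ±(G,σ) ≤ Δ(G), the maximum degree of G. -/

import Mathlib

open SimpleGraph

/-- The color set `M_n` of Máčajová–Raspaud–Škoviera:
`M_{2k} = {±1, …, ±k}` and `M_{2k+1} = {0, ±1, …, ±k}`. -/
def Mset (n : ℕ) : Set ℤ :=
  {x : ℤ | 2 * |x| ≤ (n : ℤ) ∧ (x = 0 → Odd n)}

/-- An `n`-coloring of a signed graph `(G, σ)`: a map `c : V → M_n` with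
`c u ≠ σ(uv) * c v` for every edge `uv`. -/
def IsPMColoring {V : Type*} (G : SimpleGraph V) (σ : Sym2 V → ℤˣ) (n : ℕ)
    (c : V → ℤ) : Prop :=
  (∀ v, c v ∈ Mset n) ∧ ∀ u v : V, G.Adj u v → c u ≠ (σ s(u, v) : ℤ) * c v

/-- The signed chromatic number `χ±` of Máčajová–Raspaud–Škoviera. -/
noncomputable def chiPM {V : Type*} (G : SimpleGraph V) (σ : Sym2 V → ℤˣ) : ℕ :=
  sInf {n : ℕ | ∃ c : V → ℤ, IsPMColoring G σ n c}

/-- `(G, σ)` is balanced: every circuit (cycle) has positive sign product. -/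
def IsBalanced {V : Type*} (G : SimpleGraph V) (σ : Sym2 V → ℤˣ) : Prop :=
  ∀ (u : V) (w : G.Walk u u), w.IsCycle → (w.edges.map σ).prod = 1

section SignedBrooks

variable {V : Type*} {G : SimpleGraph V} {σ : Sym2 V → ℤˣ} {n : ℕ}

/-- `c` restricts to a proper `n`-coloring of the signed subgraph induced by `S`. -/
def IsPMColoringOn (G : SimpleGraph V) (σ : Sym2 V → ℤˣ) (n : ℕ) (S : Set V) (c : V → ℤ) : Prop :=
  (∀ v ∈ S, c v ∈ Mset n) ∧ ∀ u ∈ S, ∀ v ∈ S, G.Adj u v → c u ≠ (σ s(u, v) : ℤ) * c v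

theorem isPMColoringOn_empty (c : V → ℤ) : IsPMColoringOn G σ n ∅ c := by
  simp [IsPMColoringOn]

theorem IsPMColoringOn.isPMColoring {S : Set V} {c : V → ℤ} (h : IsPMColoringOn G σ n S c)
    (hS : ∀ v, v ∈ S) : IsPMColoring G σ n c :=
  ⟨fun v => h.1 v (hS v), fun u v => h.2 u (hS u) v (hS v)⟩

theorem unit_mul_cancel (s : ℤˣ) (a : ℤ) : (s : ℤ) * ((s : ℤ) * a) = a := by
  rw [← mul_assoc, Int.units_coe_mul_self, one_mul]

theorem mul_mem_Mset (s : ℤˣ) {a : ℤ} (ha : a ∈ Mset n) : (s : ℤ) * a ∈ Mset n := by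
  rcases Int.units_eq_one_or s with rfl | rfl <;> simpa [Mset] using ha

theorem one_mem_Mset (hn : 2 ≤ n) : (1 : ℤ) ∈ Mset n := by
  simp only [Mset, Set.mem_ofPred_eq, abs_one]
  omega

/-- `M_n` has at least `n` elements. -/
theorem exists_mem_Mset_notMem (A : Finset ℤ) (hA : A.card < n) : ∃ a ∈ Mset n, a ∉ A := by
  obtain ⟨k, rfl | rfl⟩ := Nat.even_or_odd' n
  · have hcard : A.card < ((Finset.Icc (-(k : ℤ)) k).erase 0).card := by
      rw [Finset.card_erase_of_mem (by simp), Int.card_Icc]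
      omega
    obtain ⟨a, ha, haA⟩ := Finset.exists_mem_notMem_of_card_lt_card hcard
    rw [Finset.mem_erase, Finset.mem_Icc, ← abs_le] at ha
    refine ⟨a, ⟨?_, fun h => absurd h ha.1⟩, haA⟩
    push_cast
    linarith [ha.2]
  · have hcard : A.card < (Finset.Icc (-(k : ℤ)) k).card := by
      rw [Int.card_Icc]
      omega
    obtain ⟨a, ha, haA⟩ := Finset.exists_mem_notMem_of_card_lt_card hcard
    rw [Finset.mem_Icc, ← abs_le] at ha
    refine ⟨a, ⟨?_, fun _ => ⟨k, rfl⟩⟩, haA⟩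
    push_cast
    linarith

theorem IsPMColoringOn.insert_update [DecidableEq V] {S : Set V} {c : V → ℤ}
    (h : IsPMColoringOn G σ n S c) {r : V} (hr : r ∉ S) {a : ℤ} (ha : a ∈ Mset n)
    (hac : ∀ w ∈ S, G.Adj r w → a ≠ (σ s(r, w) : ℤ) * c w) :
    IsPMColoringOn G σ n (insert r S) (Function.update c r a) := by
  have hne : ∀ v ∈ S, v ≠ r := fun v hv e => hr (e ▸ hv)
  refine ⟨?_, ?_⟩
  · rintro v (rfl | hv)
    · simpa using ha
    · simpa [hne v hv] using h.1 v hv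
  · rintro u (rfl | hu) v (rfl | hv) huv
    · exact absurd huv G.irrefl
    · simpa [hne v hv] using hac v hv huv
    · intro e
      simp only [Function.update_self, Function.update_of_ne (hne u hu)] at e
      refine hac u hu huv.symm ?_
      rw [e, Sym2.eq_swap, unit_mul_cancel]
    · simpa [hne v hv, hne u hu] using h.2 u hu v hv huv

/-- A coloring of `S` extends to `r` when fewer than `n` neighbors account for all the colors
forbidden at `r`. -/
theorem IsPMColoringOn.exists_insert {S : Set V} {c : V → ℤ}
    (h : IsPMColoringOn G σ n S c) {r : V} (hr : r ∉ S) (A : Finset V) (hA : A.card < n)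
    (hAS : ∀ w ∈ S, G.Adj r w → ∃ w' ∈ A, (σ s(r, w') : ℤ) * c w' = (σ s(r, w) : ℤ) * c w) :
    ∃ c', IsPMColoringOn G σ n (insert r S) c' ∧ ∀ v ∈ S, c' v = c v := by
  classical
  obtain ⟨a, ha, haA⟩ := exists_mem_Mset_notMem (A.image fun w => (σ s(r, w) : ℤ) * c w)
    (Finset.card_image_le.trans_lt hA)
  refine ⟨_, h.insert_update hr ha fun w hw hrw e => haA ?_, fun v hv =>
    Function.update_of_ne (ne_of_mem_of_not_mem hv hr) _ _⟩
  obtain ⟨w', hw', hww'⟩ := hAS w hw hrw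
  exact Finset.mem_image.2 ⟨w', hw', hww'.trans e.symm⟩

theorem exists_adj_of_mem_of_notMem (hconn : G.Connected) {U : Set V} {u v : V} (hu : u ∈ U)
    (hv : v ∉ U) : ∃ a ∈ U, ∃ b, b ∉ U ∧ G.Adj a b := by
  obtain ⟨p⟩ := hconn.preconnected u v
  obtain ⟨d, -, hd⟩ := p.exists_boundary_dart U hu hv
  exact ⟨d.fst, hd.1, d.snd, hd.2, d.adj⟩

section Fintype

variable [Fintype V] [DecidableRel G.Adj]

/-- Greedy extension: a coloring of `S` extends to `S ∪ U` if every nonempty part of `U` has a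
neighbor outside of `S` and outside of that part. -/
theorem IsPMColoringOn.exists_union (hdeg : ∀ v, G.degree v ≤ n) {S : Set V} {c : V → ℤ}
    (h : IsPMColoringOn G σ n S c) (U : Set V) (hSU : Disjoint S U)
    (hU : ∀ U' ⊆ U, U'.Nonempty → ∃ u ∈ U', ∃ w, w ∉ S ∧ w ∉ U' ∧ G.Adj u w) :
    ∃ c', IsPMColoringOn G σ n (S ∪ U) c' ∧ ∀ v ∈ S, c' v = c v := by
  classical
  induction hk : U.ncard generalizing U with
  | zero =>
    rw [Set.ncard_eq_zero] at hk
    exact ⟨c, by simpa [hk] using h, fun _ _ => rfl⟩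
  | succ k ih =>
    obtain ⟨u, hu, w, hwS, hwU, huw⟩ := hU U subset_rfl (Set.nonempty_of_ncard_ne_zero (by omega))
    have huS : u ∉ S := fun hu' => hSU.notMem_of_mem_left hu' hu
    obtain ⟨c₁, hc₁, hcc₁⟩ := ih (U \ {u}) (hSU.mono_right Set.sdiff_subset)
      (fun U' hU' => hU U' (hU'.trans Set.sdiff_subset))
      (by rw [Set.ncard_sdiff_singleton_of_mem hu, hk, Nat.add_sub_cancel])
    have hw : w ∈ G.neighborFinset u := (G.mem_neighborFinset u w).2 huw
    obtain ⟨c₂, hc₂, hcc₂⟩ := hc₁.exists_insert (r := u) (by simp [huS])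
      ((G.neighborFinset u).erase w)
      (by
        have := hdeg u
        rw [← G.card_neighborFinset_eq_degree] at this
        exact (Finset.card_erase_lt_of_mem hw).trans_le this)
      (fun v hv huv => ⟨v, Finset.mem_erase.2
        ⟨ne_of_mem_of_not_mem hv fun hw => hw.elim hwS fun hw => hwU hw.1,
          (G.mem_neighborFinset u v).2 huv⟩, rfl⟩)
    refine ⟨c₂, ?_, fun v hv => (hcc₂ v (Or.inl hv)).trans (hcc₁ v hv)⟩
    rwa [← Set.union_insert, Set.insert_sdiff_singleton, Set.insert_eq_of_mem hu] at hc₂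

/-- A coloring of the complement of `r` extends to `r` if two neighbors of `r` forbid the same
color. -/
theorem IsPMColoringOn.exists_isPMColoring (hdeg : ∀ v, G.degree v ≤ n) {S : Set V} {c : V → ℤ}
    (h : IsPMColoringOn G σ n S c) {r y z : V} (hr : r ∉ S) (hS : ∀ v, v ≠ r → v ∈ S)
    (hy : G.Adj r y) (hz : G.Adj r z) (hyz : y ≠ z)
    (hc : (σ s(r, y) : ℤ) * c y = (σ s(r, z) : ℤ) * c z) : ∃ c', IsPMColoring G σ n c' := by
  classical
  have hzr : z ∈ G.neighborFinset r := (G.mem_neighborFinset r z).2 hz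
  obtain ⟨c', hc', -⟩ := h.exists_insert hr ((G.neighborFinset r).erase z)
    (by
      have := hdeg r
      rw [← G.card_neighborFinset_eq_degree] at this
      exact (Finset.card_erase_lt_of_mem hzr).trans_le this)
    (fun v _ hrv => by
      by_cases hvz : v = z
      · exact ⟨y, by simp [hyz, hy], by rw [hc, hvz]⟩
      · exact ⟨v, by simp [hvz, hrv], rfl⟩)
  exact ⟨c', hc'.isPMColoring fun v => or_iff_not_imp_left.2 (hS v)⟩

/-- A connected signed graph with a vertex of degree less than `n` is `n`-colorable. -/
theorem exists_isPMColoring_of_degree_lt (hconn : G.Connected) (hdeg : ∀ v, G.degree v ≤ n) {r : V}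
    (hr : G.degree r < n) : ∃ c, IsPMColoring G σ n c := by
  obtain ⟨c, hc, -⟩ := (isPMColoringOn_empty (σ := σ) (n := n) 0).exists_union hdeg {r}ᶜ (by simp)
    fun U' hU' ⟨u, hu⟩ => by
      obtain ⟨a, ha, b, hb, hab⟩ := exists_adj_of_mem_of_notMem hconn hu fun h => hU' h rfl
      exact ⟨a, ha, b, by simp, hb, hab⟩
  rw [Set.empty_union] at hc
  obtain ⟨c', hc', -⟩ := hc.exists_insert (r := r) (by simp) (G.neighborFinset r)
    (by rwa [G.card_neighborFinset_eq_degree]) fun v _ hv => ⟨v, by simpa using hv, rfl⟩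
  exact ⟨c', hc'.isPMColoring fun v => or_iff_not_imp_left.2 id⟩

/-- If a non-spanning circuit `f j, …, f r` has a vertex `f r` whose neighbors all lie on the
circuit, then the signed graph is `n`-colorable. -/
theorem exists_isPMColoring_of_circuit (hconn : G.Connected) (hdeg : ∀ v, G.degree v ≤ n)
    {f : ℕ → V} {j r : ℕ} (hjr : j ≤ r) (hinj : Set.InjOn f (Set.Icc j r))
    (hf : ∀ i, j ≤ i → i < r → G.Adj (f i) (f (i + 1))) (hclose : G.Adj (f r) (f j))
    (hend : ∀ w, G.Adj (f r) w → w ∈ f '' Set.Icc j r) (hout : ∃ v, v ∉ f '' Set.Icc j r) :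
    ∃ c, IsPMColoring G σ n c := by
  classical
  set C := f '' Set.Icc j r with hC
  have hfC : ∀ i, j ≤ i → i ≤ r → f i ∈ C := fun i h₁ h₂ => ⟨i, ⟨h₁, h₂⟩, rfl⟩
  have hfi : ∀ i k, j ≤ i → i ≤ r → j ≤ k → k ≤ r → f i = f k → i = k :=
    fun i k h₁ h₂ h₃ h₄ h => hinj ⟨h₁, h₂⟩ ⟨h₃, h₄⟩ h
  obtain ⟨i, ⟨hji, hir, x, hxC, hix⟩, hmax⟩ : ∃ i, (j ≤ i ∧ i ≤ r ∧ ∃ x, x ∉ C ∧ G.Adj (f i) x) ∧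
      ∀ k, i < k → k ≤ r → ∀ x, G.Adj (f k) x → x ∈ C := by
    obtain ⟨v, hv⟩ := hout
    obtain ⟨_, ⟨i, hi, rfl⟩, x, hx, hix⟩ := exists_adj_of_mem_of_notMem hconn (hfC r hjr le_rfl) hv
    let P : ℕ → Prop := fun i => j ≤ i ∧ ∃ x, x ∉ C ∧ G.Adj (f i) x
    have hP : P (Nat.findGreatest P r) := Nat.findGreatest_spec hi.2 ⟨hi.1, x, hx, hix⟩
    refine ⟨Nat.findGreatest P r, ⟨hP.1, Nat.findGreatest_le r, hP.2⟩, fun k hk hkr y hy => ?_⟩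
    by_contra hyC
    exact Nat.findGreatest_is_greatest hk hkr ⟨hP.1.trans hk.le, y, hyC, hy⟩
  have hir : i < r := lt_of_le_of_ne hir fun h => hxC (hend x (h ▸ hix))
  -- Color the complement of the circuit, then the vertex `f (i + 1)`.
  obtain ⟨c, hc, -⟩ := (isPMColoringOn_empty (σ := σ) (n := n) 0).exists_union hdeg Cᶜ (by simp)
    fun U' hU' ⟨u, hu⟩ => by
      obtain ⟨a, ha, b, hb, hab⟩ := exists_adj_of_mem_of_notMem hconn hu
        fun h => hU' h (hfC r hjr le_rfl)
      exact ⟨a, ha, b, by simp, hb, hab⟩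
  rw [Set.empty_union] at hc
  have hi1 : f (i + 1) ∈ C := hfC _ (by omega) hir
  have hx1 : x ≠ f (i + 1) := fun h => hxC (h ▸ hi1)
  have hc₁ := hc.insert_update (r := f (i + 1)) (by simpa using hi1)
    (mul_mem_Mset (σ s(f i, f (i + 1))) (mul_mem_Mset (σ s(f i, x)) (hc.1 x hxC)))
    fun w hw hadj => absurd (hmax _ (Nat.lt_succ_self i) hir w hadj) hw
  -- Continue along the circuit up to the vertex preceding `f i`.
  obtain ⟨c₂, hc₂, hcc₂⟩ := hc₁.exists_union hdeg (C \ {f i, f (i + 1)})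
    (by
      rw [Set.disjoint_left]
      rintro v (rfl | hv) ⟨hvC, hv'⟩
      · exact hv' (by simp)
      · exact hv hvC)
    (by
      rintro U' hU' ⟨u, hu⟩
      have next : ∀ k l, f k ∈ U' → j ≤ l → l ≤ r → l ≠ i + 1 → f l ∉ U' → G.Adj (f k) (f l) →
          ∃ u ∈ U', ∃ w, w ∉ insert (f (i + 1)) Cᶜ ∧ w ∉ U' ∧ G.Adj u w :=
        fun k l hk hjl hlr hl hlU hadj => ⟨f k, hk, f l, by
          rintro (h | h)
          · exact hl (hfi _ _ hjl hlr (by omega) hir h)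
          · exact h (hfC l hjl hlr), hlU, hadj⟩
      have hiU : f i ∉ U' := fun h => (hU' h).2 (by simp)
      have hi1U : f (i + 1) ∉ U' := fun h => (hU' h).2 (by simp)
      by_cases hlow : ∃ k, j ≤ k ∧ k ≤ i ∧ f k ∈ U'
      · obtain ⟨k, hjk, hki, hk⟩ := hlow
        let P : ℕ → Prop := fun k => j ≤ k ∧ f k ∈ U'
        have hP : P (Nat.findGreatest P i) := Nat.findGreatest_spec hki ⟨hjk, hk⟩
        have hle : Nat.findGreatest P i ≤ i := Nat.findGreatest_le i
        have hgt := fun m => @Nat.findGreatest_is_greatest m P _ i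
        generalize Nat.findGreatest P i = m at hP hle hgt
        have hmi : m ≠ i := fun h => hiU (h ▸ hP.2)
        have hjm := hP.1
        exact next m (m + 1) hP.2 (by omega) (by omega) (by omega)
          (fun h => hgt (m + 1) (by omega) (by omega) ⟨by omega, h⟩) (hf m hjm (by omega))
      · obtain ⟨k, ⟨hjk, hkr⟩, rfl⟩ := (hU' hu).1
        let P : ℕ → Prop := fun k => j ≤ k ∧ f k ∈ U'
        have hP : P (Nat.findGreatest P r) := Nat.findGreatest_spec hkr ⟨hjk, hu⟩
        have hle : Nat.findGreatest P r ≤ r := Nat.findGreatest_le r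
        have hgt := fun m => @Nat.findGreatest_is_greatest m P _ r
        generalize Nat.findGreatest P r = m at hP hle hgt
        have hjm := hP.1
        have him : i < m := by
          by_contra h
          exact hlow ⟨m, hjm, by omega, hP.2⟩
        rcases hle.eq_or_lt with rfl | hmr
        · exact next m j hP.2 le_rfl hjr (by omega) (fun h => hlow ⟨j, le_rfl, hji, h⟩) hclose
        · exact next m (m + 1) hP.2 (by omega) (by omega) (by omega)
            (fun h => hgt (m + 1) (by omega) (by omega) ⟨by omega, h⟩) (hf m hjm hmr))
  have hne : f i ≠ f (i + 1) := (hf i hji hir).ne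
  refine hc₂.exists_isPMColoring hdeg (r := f i) (y := x) (z := f (i + 1)) ?_ ?_ hix (hf i hji hir)
    hx1 ?_
  · rintro ((h | h) | h)
    · exact hne h
    · exact h (hfC i hji hir.le)
    · exact h.2 (by simp)
  · intro v hv
    by_cases hvC : v ∈ C
    · by_cases hv1 : v = f (i + 1)
      · exact Or.inl (Or.inl hv1)
      · exact Or.inr ⟨hvC, by simp [hv, hv1]⟩
    · exact Or.inl (Or.inr hvC)
  · rw [hcc₂ _ (Or.inl rfl), hcc₂ _ (Or.inr hxC), Function.update_self, Function.update_of_ne hx1,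
      unit_mul_cancel]

/-- If `f 0, …, f r` is a spanning path such that `f 0` and `f 2` may both forbid the color `1`
at `f 1`, then the signed graph is `n`-colorable, provided that `f 1` has a third neighbor. -/
theorem exists_isPMColoring_of_spanning_path (hdeg : ∀ v, G.degree v ≤ n) (hn : 2 ≤ n)
    {f : ℕ → V} {r : ℕ} (hr : 2 ≤ r) (hinj : Set.InjOn f (Set.Iic r))
    (hf : ∀ i, i < r → G.Adj (f i) (f (i + 1))) (hspan : ∀ v, ∃ i ≤ r, f i = v)
    (htriple : G.Adj (f 0) (f 2) → σ s(f 0, f 2) ≠ σ s(f 1, f 0) * σ s(f 1, f 2))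
    (hthird : ∃ w, G.Adj (f 1) w ∧ w ≠ f 0 ∧ w ≠ f 2) :
    ∃ c, IsPMColoring G σ n c := by
  classical
  have hfi : ∀ i k, i ≤ r → k ≤ r → f i = f k → i = k := fun i k h₁ h₂ h => hinj h₁ h₂ h
  have h01 : f 0 ≠ f 1 := fun h => absurd (hfi 0 1 (by omega) (by omega) h) (by omega)
  have h02 : f 0 ≠ f 2 := fun h => absurd (hfi 0 2 (by omega) (by omega) h) (by omega)
  have h12 : f 1 ≠ f 2 := fun h => absurd (hfi 1 2 (by omega) (by omega) h) (by omega)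
  have hc₀ := (isPMColoringOn_empty (G := G) (σ := σ) (n := n) 0).insert_update
    (Set.notMem_empty (f 2)) (mul_mem_Mset (σ s(f 1, f 2)) (one_mem_Mset hn)) (by simp)
  have hc₁ := hc₀.insert_update (r := f 0) (by simpa using h02)
    (mul_mem_Mset (σ s(f 1, f 0)) (one_mem_Mset hn)) (by
      rintro w (rfl | hw) hadj
      · rw [Function.update_self, mul_one, mul_one]
        intro h
        apply htriple hadj
        norm_cast at h
        rw [h, mul_assoc, Int.units_mul_self, mul_one]
      · exact hw.elim)
  obtain ⟨t, htr, ht, ht0, ht2⟩ : ∃ t ≤ r, G.Adj (f 1) (f t) ∧ f t ≠ f 0 ∧ f t ≠ f 2 := by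
    obtain ⟨w, hw⟩ := hthird
    obtain ⟨t, htr, rfl⟩ := hspan w
    exact ⟨t, htr, hw⟩
  obtain ⟨c₂, hc₂, hcc₂⟩ := hc₁.exists_union hdeg {f 0, f 1, f 2}ᶜ
    (by
      rw [Set.disjoint_left]
      rintro v (rfl | rfl | hv) hv'
      · exact hv' (by simp)
      · exact hv' (by simp)
      · exact hv)
    (by
      rintro U' hU' ⟨u, hu⟩
      have hlt : ∀ i, f i ∈ U' → 3 ≤ i := fun i hi => by
        by_contra h
        have : i = 0 ∨ i = 1 ∨ i = 2 := by omega
        rcases this with rfl | rfl | rfl <;> exact hU' hi (by simp)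
      have next : ∀ k l, f k ∈ U' → 3 ≤ l → l ≤ r → f l ∉ U' → G.Adj (f k) (f l) →
          ∃ u ∈ U', ∃ w, w ∉ insert (f 0) (insert (f 2) (∅ : Set V)) ∧ w ∉ U' ∧ G.Adj u w :=
        fun k l hk hl hlr hlU hadj => ⟨f k, hk, f l, by
          rintro (h | h | h)
          · have := hfi _ _ hlr (by omega) h
            omega
          · have := hfi _ _ hlr (by omega) h
            omega
          · exact h, hlU, hadj⟩
      have ht3 : 3 ≤ t := by
        by_contra h
        have : t = 0 ∨ t = 1 ∨ t = 2 := by omega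
        rcases this with rfl | rfl | rfl
        · exact ht0 rfl
        · exact ht.ne rfl
        · exact ht2 rfl
      by_cases htU : f t ∈ U'
      · exact ⟨f t, htU, f 1, by simp [h01.symm, h12], fun h => by simpa using hlt 1 h, ht.symm⟩
      by_cases hlow : ∃ k ≤ t, f k ∈ U'
      · obtain ⟨k, hkt, hk⟩ := hlow
        let P : ℕ → Prop := fun k => f k ∈ U'
        have hP : P (Nat.findGreatest P t) := Nat.findGreatest_spec hkt hk
        have hle : Nat.findGreatest P t ≤ t := Nat.findGreatest_le t
        have hgt := fun m => @Nat.findGreatest_is_greatest m P _ t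
        generalize Nat.findGreatest P t = m at hP hle hgt
        have hmt : m ≠ t := fun h => htU (h ▸ hP)
        have := hlt m hP
        exact next m (m + 1) hP (by omega) (by omega) (hgt (m + 1) (by omega) (by omega))
          (hf m (by omega))
      · obtain ⟨k, hkr, rfl⟩ := hspan u
        have hex : ∃ k, f k ∈ U' := ⟨k, hu⟩
        have hP := Nat.find_spec hex
        have hle := Nat.find_min' hex hu
        have hmin := fun m => @Nat.find_min _ _ hex m
        generalize Nat.find hex = m at hP hle hmin
        have htm : t < m := by
          by_contra h
          exact hlow ⟨m, by omega, hP⟩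
        obtain ⟨l, rfl⟩ : ∃ l, m = l + 1 := ⟨m - 1, by omega⟩
        exact next (l + 1) l hP (by omega) (by omega) (hmin l (by omega)) (hf l (by omega)).symm)
  refine hc₂.exists_isPMColoring hdeg (r := f 1) (y := f 0) (z := f 2) ?_ ?_
    (hf 0 (by omega)).symm (hf 1 (by omega)) h02 ?_
  · simp [h01.symm, h12]
  · intro v hv
    by_cases hv0 : v = f 0
    · simp [hv0]
    by_cases hv2 : v = f 2
    · simp [hv2]
    exact Or.inr (by simp [hv, hv0, hv2])
  · rw [hcc₂ _ (Or.inl rfl), hcc₂ _ (Or.inr (Or.inl rfl)), Function.update_self,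
      Function.update_of_ne h02.symm, Function.update_self, unit_mul_cancel, unit_mul_cancel]

/-- If `y` and `z` may both forbid the color `1` at their common neighbor `x`, then a connected
`n`-regular signed graph with `3 ≤ n` is `n`-colorable. -/
theorem exists_isPMColoring_of_triple (hconn : G.Connected) (hdeg : ∀ v, G.degree v = n)
    (hn : 3 ≤ n) {x y z : V} (hy : G.Adj x y) (hz : G.Adj x z) (hyz : y ≠ z)
    (htriple : G.Adj y z → σ s(y, z) ≠ σ s(x, y) * σ s(x, z)) :
    ∃ c, IsPMColoring G σ n c := by
  classical
  have hdeg' : ∀ v, G.degree v ≤ n := fun v => (hdeg v).le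
  let P : ℕ → Prop := fun r => ∃ f : ℕ → V, Set.InjOn f (Set.Iic r) ∧
    (∀ i < r, G.Adj (f i) (f (i + 1))) ∧ f 0 = y ∧ f 1 = x ∧ f 2 = z
  have hP2 : P 2 := by
    refine ⟨fun i => if i = 0 then y else if i = 1 then x else z, ?_, ?_, by simp⟩
    · intro i hi k hk h
      rw [Set.mem_Iic] at hi hk
      interval_cases i <;> interval_cases k <;> simp_all [hy.ne, hz.ne, hy.ne', hz.ne']
    · intro i hi
      interval_cases i
      · simpa using hy.symm
      · simpa using hz
  have hPcard : ∀ r, P r → r < Fintype.card V := by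
    rintro r ⟨f, hf, -⟩
    have h := Finset.card_le_card_of_injOn (s := Finset.range (r + 1)) (t := Finset.univ) f
      (fun _ _ => Finset.mem_univ _) (hf.mono fun i hi => by
        rw [Set.mem_Iic]
        exact Nat.lt_succ_iff.1 (Finset.mem_range.1 hi))
    rwa [Finset.card_range, Finset.card_univ] at h
  have h2r := Nat.le_findGreatest (hPcard 2 hP2).le hP2
  have hPr : P (Nat.findGreatest P (Fintype.card V)) :=
    Nat.findGreatest_spec (hPcard 2 hP2).le hP2
  have hmax := fun m => @Nat.findGreatest_is_greatest m P _ (Fintype.card V)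
  generalize Nat.findGreatest P (Fintype.card V) = r at h2r hPr hmax
  obtain ⟨f, hinj, hf, rfl, rfl, rfl⟩ := hPr
  have hend : ∀ w, G.Adj (f r) w → ∃ i ≤ r, f i = w := by
    by_contra! hcon
    obtain ⟨w, hw, hwf⟩ := hcon
    have hP : P (r + 1) := by
      have hup : ∀ i ≤ r, Function.update f (r + 1) w i = f i := fun i hi =>
        Function.update_of_ne (by omega) _ _
      refine ⟨Function.update f (r + 1) w, ?_, fun i hi => ?_, hup _ (by omega), hup _ (by omega),
        hup _ h2r⟩
      · intro i hi k hk h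
        rw [Set.mem_Iic] at hi hk
        rcases hi.eq_or_lt with rfl | hi <;> rcases hk.eq_or_lt with rfl | hk
        · rfl
        · rw [Function.update_self, hup k (by omega)] at h
          exact absurd h.symm (hwf k (by omega))
        · rw [Function.update_self, hup i (by omega)] at h
          exact absurd h (hwf i (by omega))
        · rw [hup i (by omega), hup k (by omega)] at h
          exact hinj (Nat.lt_succ_iff.1 hi) (Nat.lt_succ_iff.1 hk) h
      · rcases (Nat.lt_succ_iff.1 hi).eq_or_lt with rfl | hi
        · rwa [Function.update_self, hup i le_rfl]
        · rw [hup i (by omega), hup (i + 1) (by omega)]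
          exact hf i hi
    exact hmax (r + 1) (by omega) (hPcard _ hP).le hP
  by_cases hspan : ∀ v, ∃ i ≤ r, f i = v
  · refine exists_isPMColoring_of_spanning_path hdeg' (by omega) h2r hinj hf hspan htriple ?_
    have hcard : ({f 0, f 2} : Finset V).card < (G.neighborFinset (f 1)).card := by
      rw [G.card_neighborFinset_eq_degree, hdeg]
      exact Finset.card_le_two.trans_lt hn
    obtain ⟨w, hw, hw'⟩ := Finset.exists_mem_notMem_of_card_lt_card hcard
    exact ⟨w, by simpa using hw, by simpa using hw'⟩
  · push Not at hspan
    obtain ⟨v, hv⟩ := hspan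
    obtain ⟨l, rfl⟩ : ∃ l, r = l + 1 := ⟨r - 1, by omega⟩
    have hex : ∃ j, G.Adj (f (l + 1)) (f j) := ⟨l, (hf l (by omega)).symm⟩
    have hle : Nat.find hex ≤ l := Nat.find_min' hex (hf l (by omega)).symm
    refine exists_isPMColoring_of_circuit hconn hdeg' (f := f) (j := Nat.find hex) (r := l + 1)
      (by omega) (hinj.mono fun i hi => hi.2) (fun i _ hi => hf i hi) (Nat.find_spec hex)
      (fun w hw => ?_) ⟨v, ?_⟩
    · obtain ⟨i, hi, rfl⟩ := hend w hw
      exact ⟨i, ⟨Nat.find_min' hex hw, hi⟩, rfl⟩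
    · rintro ⟨i, hi, rfl⟩
      exact hv i hi.2 rfl

end Fintype

theorem prod_edges_eq_of_potential {s : V → ℤˣ} (hs : ∀ a b, G.Adj a b → σ s(a, b) = s a * s b)
    {u v : V} (p : G.Walk u v) : (p.edges.map σ).prod = s u * s v := by
  induction p with
  | nil => simp
  | @cons u w v h p ih =>
    rw [Walk.edges_cons, List.map_cons, List.prod_cons, ih, hs _ _ h, mul_assoc, ← mul_assoc (s w),
      Int.units_mul_self, one_mul]

theorem isBalanced_of_potential {s : V → ℤˣ} (hs : ∀ a b, G.Adj a b → σ s(a, b) = s a * s b) :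
    IsBalanced G σ := fun u w _ => by
  rw [prod_edges_eq_of_potential hs, Int.units_mul_self]

theorem SimpleGraph.Walk.IsPath.exists_potential (τ : Sym2 V → ℤˣ) {u v : V} {p : G.Walk u v}
    (hp : p.IsPath) : ∃ s : V → ℤˣ, s u * s v = (p.edges.map τ).prod ∧
      ∀ a b, s(a, b) ∈ p.edges → τ s(a, b) = s a * s b := by
  classical
  induction p with
  | nil => exact ⟨1, by simp⟩
  | @cons u w v h p ih =>
    rw [Walk.cons_isPath_iff] at hp
    obtain ⟨s, hs, hse⟩ := ih hp.1
    have hne : ∀ x ∈ p.support, x ≠ u := fun x hx e => hp.2 (e ▸ hx)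
    refine ⟨Function.update s u (τ s(u, w) * s w), ?_, fun a b hab => ?_⟩
    · rw [Function.update_self, Function.update_of_ne (hne v p.end_mem_support), Walk.edges_cons,
        List.map_cons, List.prod_cons, ← hs, mul_assoc]
    · have hw := hne w p.start_mem_support
      have key : τ s(u, w) = (τ s(u, w) * s w) * s w := by
        rw [mul_assoc, Int.units_mul_self, mul_one]
      rw [Walk.edges_cons, List.mem_cons] at hab
      rcases hab with hab | hab
      · rcases Sym2.eq_iff.1 hab with ⟨rfl, rfl⟩ | ⟨rfl, rfl⟩
        · rwa [Function.update_self, Function.update_of_ne hw]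
        · rwa [Function.update_self, Function.update_of_ne hw, Sym2.eq_swap, mul_comm]
      · rw [Function.update_of_ne (hne a (p.fst_mem_support_of_mem_edges hab)),
          Function.update_of_ne (hne b (p.snd_mem_support_of_mem_edges hab)), hse a b hab]

theorem SimpleGraph.Walk.IsCycle.exists_potential {τ : Sym2 V → ℤˣ} {u : V} {p : G.Walk u u}
    (hp : p.IsCycle) (hτ : (p.edges.map τ).prod = 1) :
    ∃ s : V → ℤˣ, ∀ a b, s(a, b) ∈ p.edges → τ s(a, b) = s a * s b := by
  cases p with
  | nil => exact absurd hp (by simp)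
  | @cons _ w _ h p =>
    rw [Walk.cons_isCycle_iff] at hp
    obtain ⟨s, hs, hse⟩ := hp.1.exists_potential τ
    refine ⟨s, fun a b hab => ?_⟩
    rw [Walk.edges_cons, List.map_cons, List.prod_cons, ← hs] at hτ
    have key : τ s(u, w) = s w * s u := by
      rw [eq_inv_of_mul_eq_one_left hτ, Int.units_inv_eq_self]
    rw [Walk.edges_cons, List.mem_cons] at hab
    rcases hab with hab | hab
    · rcases Sym2.eq_iff.1 hab with ⟨rfl, rfl⟩ | ⟨rfl, rfl⟩
      · rw [key, mul_comm]
      · rw [Sym2.eq_swap, key]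
    · exact hse a b hab

/-- If no two neighbors of a vertex may forbid the same nonzero color there, then the connected
signed graph is a balanced complete graph. -/
theorem isBalanced_and_complete_of_forall_triple (hconn : G.Connected)
    (h : ∀ x y z, G.Adj x y → G.Adj x z → y ≠ z →
      G.Adj y z ∧ σ s(y, z) = σ s(x, y) * σ s(x, z)) :
    IsBalanced G σ ∧ ∀ u v : V, u ≠ v → G.Adj u v := by
  classical
  have hcomp : ∀ u v : V, u ≠ v → G.Adj u v := by
    intro u v huv
    by_contra hadj
    obtain ⟨a, ha, b, hb, hab⟩ := exists_adj_of_mem_of_notMem hconn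
      (U := {w | w = u ∨ G.Adj u w}) (Or.inl rfl) fun h => h.elim (fun h => huv h.symm) hadj
    refine hb ?_
    rcases ha with rfl | ha
    · exact Or.inr hab
    · by_cases hbu : b = u
      · exact Or.inl hbu
      · exact Or.inr (h a u b ha.symm hab (Ne.symm hbu)).1
  obtain ⟨o⟩ := hconn.nonempty
  refine ⟨isBalanced_of_potential (s := fun v => if v = o then 1 else σ s(o, v)) ?_, hcomp⟩
  intro a b hab
  by_cases ha : a = o
  · have hb : b ≠ o := fun hb => hab.ne (ha.trans hb.symm)
    simp [ha, hb]
  · by_cases hb : b = o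
    · simp [ha, hb, Sym2.eq_swap]
    · simpa [ha, hb] using (h o a b (hcomp _ _ (Ne.symm ha)) (hcomp _ _ (Ne.symm hb)) hab.ne).2

/-- A signed circuit is `2`-colorable unless it is balanced odd or unbalanced even. -/
theorem exists_isPMColoring_two [Fintype V] [DecidableRel G.Adj] (hconn : G.Connected)
    (hdeg : ∀ v, G.degree v = 2) (hodd : ¬(IsBalanced G σ ∧ Odd (Fintype.card V)))
    (heven : ¬(¬IsBalanced G σ ∧ Even (Fintype.card V))) :
    ∃ c, IsPMColoring G σ 2 c := by
  classical
  have hncard : ∀ v, (G.neighborSet v).ncard = 2 := fun v => by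
    rw [← hdeg v, ← G.card_neighborSet_eq_degree, Set.ncard_eq_toFinset_card', Set.toFinset_card]
  obtain ⟨o⟩ := hconn.nonempty
  obtain ⟨p, hp, hverts⟩ := IsCycles.exists_cycle_toSubgraph_verts_eq_connectedComponentSupp
    (G := G) (c := G.connectedComponentMk o) (v := o) (fun v _ => hncard v) rfl
    (Set.nonempty_of_ncard_ne_zero (by simp [hncard]))
  have hsupp : ∀ v, v ∈ p.support := fun v => by
    rw [← Walk.mem_verts_toSubgraph, hverts]
    exact ConnectedComponent.sound (hconn.preconnected v o)
  have hedge : ∀ a b, G.Adj a b → s(a, b) ∈ p.edges := fun a b hab => by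
    have heq : p.toSubgraph.neighborSet a = G.neighborSet a :=
      Set.eq_of_subset_of_ncard_le (p.toSubgraph.neighborSet_subset a)
        (by rw [hncard, hp.ncard_neighborSet_toSubgraph_eq_two (hsupp a)])
    have hb : b ∈ p.toSubgraph.neighborSet a := heq ▸ hab
    rwa [Subgraph.mem_neighborSet, ← Subgraph.mem_edgeSet, Walk.mem_edges_toSubgraph] at hb
  have hlen : p.length = Fintype.card V :=
    (Walk.isHamiltonianCycle_isCycle_and_isHamiltonian_tail.2 ⟨hp, hp.isPath_tail.isHamiltonian_of_mem
      fun v => by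
        rw [p.support_tail_of_not_nil hp.not_nil]
        by_cases hv : v = o
        · exact hv ▸ p.end_mem_tail_support hp.not_nil
        · exact (p.mem_support_iff.1 (hsupp v)).resolve_left hv⟩).length_eq
  by_cases hprod : (p.edges.map fun e => -1 * σ e).prod = 1
  · obtain ⟨s, hs⟩ := hp.exists_potential hprod
    refine ⟨fun v => s v, fun v => by simpa using mul_mem_Mset (s v) (one_mem_Mset le_rfl),
      fun a b hab h => ?_⟩
    have h' := hs a b (hedge a b hab)
    replace h : s a = σ s(a, b) * s b := Units.ext h
    rw [h, mul_assoc, Int.units_mul_self, mul_one, neg_one_mul] at h'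
    exact units_ne_neg_self _ h'.symm
  · rw [List.prod_map_mul, List.map_const', List.prod_replicate, Walk.length_edges, hlen] at hprod
    rcases Nat.even_or_odd (Fintype.card V) with hV | hV
    · rw [hV.neg_one_pow, one_mul] at hprod
      exact absurd ⟨fun hb => hprod (hb o p hp), hV⟩ heven
    · rw [hV.neg_one_pow, neg_one_mul] at hprod
      have hprod' : (p.edges.map σ).prod = 1 :=
        (Int.units_eq_one_or _).resolve_right fun h => hprod (by rw [h, neg_neg])
      obtain ⟨s, hs⟩ := hp.exists_potential hprod'
      exact absurd ⟨isBalanced_of_potential fun a b hab => hs a b (hedge a b hab), hV⟩ hodd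

end SignedBrooks

/-- Brooks' theorem for signed graphs: if a simple connected signed graph
`(G, σ)` is neither a balanced complete graph, nor a balanced odd circuit, nor
an unbalanced even circuit, then `χ±(G,σ) ≤ Δ(G)`. -/
theorem signed_brooks {V : Type*} [Fintype V] (G : SimpleGraph V)
    [DecidableRel G.Adj] (σ : Sym2 V → ℤˣ) (hconn : G.Connected)
    (hcomplete : ¬(IsBalanced G σ ∧ ∀ u v : V, u ≠ v → G.Adj u v))
    (hoddcirc : ¬(IsBalanced G σ ∧ (∀ v : V, G.degree v = 2) ∧ Odd (Fintype.card V)))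
    (hevencirc : ¬(¬IsBalanced G σ ∧ (∀ v : V, G.degree v = 2) ∧ Even (Fintype.card V))) :
    chiPM G σ ≤ G.maxDegree := by
  refine Nat.sInf_le ?_
  by_cases hlt : ∃ r, G.degree r < G.maxDegree
  · obtain ⟨r, hr⟩ := hlt
    exact exists_isPMColoring_of_degree_lt hconn G.degree_le_maxDegree hr
  have hdeg : ∀ v, G.degree v = G.maxDegree := fun v =>
    (G.degree_le_maxDegree v).antisymm (not_lt.1 fun h => hlt ⟨v, h⟩)
  obtain ⟨x, y, z, hy, hz, hyz, htriple⟩ : ∃ x y z, G.Adj x y ∧ G.Adj x z ∧ y ≠ z ∧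
      (G.Adj y z → σ s(y, z) ≠ σ s(x, y) * σ s(x, z)) := by
    by_contra! h
    exact hcomplete (isBalanced_and_complete_of_forall_triple hconn h)
  have h2 : 2 ≤ G.maxDegree := by
    classical
    rw [← hdeg x, ← G.card_neighborFinset_eq_degree, ← Finset.card_pair hyz]
    exact Finset.card_le_card (by simp [Finset.insert_subset_iff, hy, hz])
  rcases h2.eq_or_lt with h2 | h3
  · rw [← h2] at hdeg ⊢
    exact exists_isPMColoring_two hconn hdeg (fun h => hoddcirc ⟨h.1, hdeg, h.2⟩)
      fun h => hevencirc ⟨h.1, hdeg, h.2⟩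
  · exact exists_isPMColoring_of_triple hconn hdeg h3 hy hz hyz htriple
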